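/- Let d ≥ 1, r > 0, and let e ∈ ℝ^d be a unit vector. Then there exist C > 0 and σ₀ > 0 such that for all σ ∈ (0, σ₀) and all η ∈ [0, min(r, √σ)]: ∫_{ℝ^d ∖ B((η−r)e, r)} (2πσ²)^{−d/2} exp(−‖z‖²/(2σ²)) dz − ∫_{B((η+r)e, r)} (2πσ²)^{−d/2} exp(−‖z‖²/(2σ²)) dz ≤ Cσ, where B(c, r) denotes the closed Euclidean ball of radius r centered at c. (Geometrically: B((η−r)e, r) and B((η+r)e, r) are the two balls of radius r tangent to the hyperplane {z : ⟨z, e⟩ = η} at the point ηe, on the side containing 0 and the opposite side respectively, and the Gaussian mass outside the first ball exceeds the Gaussian mass inside the second by at most Cσ, uniformly over η ∈ [0, min(r, √σ)].) -/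

import Mathlib

open MeasureTheory Real

open ProbabilityTheory in
theorem integrable_gaussianPDFReal_mul_sq (v : NNReal) (hv : v ≠ 0) :
    Integrable fun x : ℝ ↦ gaussianPDFReal 0 v x * x ^ 2 := by
  have h := (memLp_id_gaussianReal (μ := 0) (v := v) 2).integrable_sq
  rw [gaussianReal_of_var_ne_zero _ hv,
    integrable_withDensity_iff_integrable_smul' (measurable_gaussianPDF _ _)
      (ae_of_all _ fun _ ↦ gaussianPDF_lt_top)] at h
  simpa using h

open ProbabilityTheory in
theorem integral_gaussianPDFReal_mul_sq (v : NNReal) (hv : v ≠ 0) :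
    ∫ x : ℝ, gaussianPDFReal 0 v x * x ^ 2 = v := by
  have h := integral_gaussianReal_eq_integral_smul (μ := 0) (f := fun x : ℝ ↦ x ^ 2) hv
  simp only [smul_eq_mul] at h
  rw [← h, ← variance_fun_id_gaussianReal (μ := 0) (v := v),
    variance_of_integral_eq_zero aemeasurable_id' integral_id_gaussianReal]

open ProbabilityTheory in
theorem integral_prod_gaussianPDFReal_mul_sum_sq (n : ℕ) (v : NNReal) (hv : v ≠ 0) :
    Integrable (fun y : Fin n → ℝ ↦ (∏ i, gaussianPDFReal 0 v (y i)) * ∑ i, y i ^ 2) ∧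
    ∫ y : Fin n → ℝ, (∏ i, gaussianPDFReal 0 v (y i)) * ∑ i, y i ^ 2 = n * v := by
  let g : Fin n → Fin n → ℝ → ℝ := fun i j x ↦
    if j = i then gaussianPDFReal 0 v x * x ^ 2 else gaussianPDFReal 0 v x
  have hg : ∀ y : Fin n → ℝ, (∏ i, gaussianPDFReal 0 v (y i)) * ∑ i, y i ^ 2
      = ∑ i, ∏ j, g i j (y j) := by
    intro y
    rw [Finset.mul_sum]
    refine Finset.sum_congr rfl fun i _ ↦ ?_
    have : ∀ j, g i j (y j) = gaussianPDFReal 0 v (y j) * if j = i then y j ^ 2 else 1 := by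
      intro j; simp only [g]; split_ifs <;> simp
    simp_rw [this, Finset.prod_mul_distrib]
    simp
  have hgi : ∀ i, Integrable (fun y : Fin n → ℝ ↦ ∏ j, g i j (y j)) := by
    intro i
    refine Integrable.fintype_prod fun j ↦ ?_
    by_cases h : j = i
    · simpa [g, h] using integrable_gaussianPDFReal_mul_sq v hv
    · simpa [g, h] using integrable_gaussianPDFReal 0 v
  have hint : ∀ i, ∫ y : Fin n → ℝ, ∏ j, g i j (y j) = v := by
    intro i
    rw [integral_fintype_prod_volume_eq_prod]
    have : ∀ j, ∫ x, g i j x = if j = i then (v : ℝ) else 1 := by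
      intro j
      by_cases h : j = i
      · simpa [g, h] using integral_gaussianPDFReal_mul_sq v hv
      · simpa [g, h] using integral_gaussianPDFReal_eq_one 0 hv
    simp [this]
  simp_rw [hg]
  refine ⟨integrable_finsetSum _ fun i _ ↦ hgi i, ?_⟩
  rw [integral_finsetSum _ fun i _ ↦ hgi i]
  simp [hint]

theorem near_or_far_of_gap {r η s q : ℝ} (hr : 0 < r) (hη : |η| ≤ r / 2)
    (h : 2 * r * |s - η| < (s - η) ^ 2 + q) : |s - η| ≤ q / r ∨ 1 ≤ 4 / r ^ 2 * s ^ 2 := by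
  by_cases ht : |s - η| ≤ r
  · left
    rw [le_div_iff₀ hr]
    have := mul_le_mul_of_nonneg_left ht (abs_nonneg (s - η))
    rw [abs_mul_abs_self] at this
    nlinarith
  · right
    have h1 : r / 2 ≤ |s| := by
      have := abs_sub s η
      linarith
    have h2 : (r / 2) ^ 2 ≤ s ^ 2 := by
      rw [← sq_abs s]; gcongr
    rw [div_mul_eq_mul_div, le_div_iff₀ (by positivity)]
    linarith

open ProbabilityTheory in
theorem gaussianPDFReal_le (v : NNReal) (x : ℝ) : gaussianPDFReal 0 v x ≤ (√(2 * π * v))⁻¹ := by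
  rw [gaussianPDFReal]
  refine mul_le_of_le_one_right (by positivity) (Real.exp_le_one_iff.2 ?_)
  rw [neg_div]
  exact neg_nonpos.2 (by positivity)

open ProbabilityTheory in
theorem integral_gap_gaussianPDFReal_le (v : NNReal) (hv : v ≠ 0) {r η q : ℝ} (hr : 0 < r)
    (hη : |η| ≤ r / 2) (hq : 0 ≤ q) :
    ∫ s, {s : ℝ | 2 * r * |s - η| < (s - η) ^ 2 + q}.indicator (gaussianPDFReal 0 v) s
      ≤ (√(2 * π * v))⁻¹ * (2 / r) * q + 4 / r ^ 2 * v := by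
  have hI1 : Integrable ((Set.Icc (η - q / r) (η + q / r)).indicator
      fun _ ↦ (√(2 * π * v))⁻¹) := by
    rw [integrable_indicator_iff measurableSet_Icc]
    exact integrableOn_const (by simp)
  have hI2 := (integrable_gaussianPDFReal_mul_sq v hv).const_mul (4 / r ^ 2)
  calc _ ≤ ∫ s, ((Set.Icc (η - q / r) (η + q / r)).indicator (fun _ ↦ (√(2 * π * v))⁻¹) s
        + 4 / r ^ 2 * (gaussianPDFReal 0 v s * s ^ 2)) := by
        refine integral_mono_of_nonneg (ae_of_all _ fun s ↦ ?_) (hI1.add hI2)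
          (ae_of_all _ fun s ↦ ?_)
        · exact Set.indicator_nonneg (fun s _ ↦ gaussianPDFReal_nonneg 0 v s) s
        · have hN := gaussianPDFReal_nonneg 0 v s
          have hA : 0 ≤ (Set.Icc (η - q / r) (η + q / r)).indicator
              (fun _ ↦ (√(2 * π * v))⁻¹) s := Set.indicator_nonneg (fun _ _ ↦ by positivity) s
          have hB : 0 ≤ 4 / r ^ 2 * (gaussianPDFReal 0 v s * s ^ 2) := by positivity
          beta_reduce
          by_cases hs : s ∈ {s : ℝ | 2 * r * |s - η| < (s - η) ^ 2 + q}
          · rw [Set.indicator_of_mem hs]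
            rcases near_or_far_of_gap hr hη hs with h | h
            · rw [abs_le] at h
              have hmem : s ∈ Set.Icc (η - q / r) (η + q / r) := ⟨by linarith, by linarith⟩
              rw [Set.indicator_of_mem hmem] at hA ⊢
              have := gaussianPDFReal_le v s
              linarith
            · have := mul_le_mul_of_nonneg_left h hN
              linarith
          · rw [Set.indicator_of_notMem hs]
            exact add_nonneg hA hB
    _ = _ := by
        rw [integral_add hI1 hI2, integral_const_mul, integral_gaussianPDFReal_mul_sq v hv,
          integral_indicator measurableSet_Icc, setIntegral_const]
        have : 0 ≤ q / r := by positivity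
        simp only [measureReal_def, Real.volume_Icc, smul_eq_mul]
        rw [ENNReal.toReal_ofReal (by linarith)]
        ring

open ProbabilityTheory in
theorem setIntegral_gap_gaussianPDFReal_prod_le (n : ℕ) (v : NNReal) (hv : v ≠ 0) {r η : ℝ}
    (hr : 0 < r) (hη : |η| ≤ r / 2) :
    ∫ p in {p : ℝ × (Fin n → ℝ) | 2 * r * |p.1 - η| < (p.1 - η) ^ 2 + ∑ i, p.2 i ^ 2},
      gaussianPDFReal 0 v p.1 * ∏ i, gaussianPDFReal 0 v (p.2 i)
      ≤ (√(2 * π * v))⁻¹ * (2 / r) * (n * v) + 4 / r ^ 2 * v := by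
  have hS : MeasurableSet
      {p : ℝ × (Fin n → ℝ) | 2 * r * |p.1 - η| < (p.1 - η) ^ 2 + ∑ i, p.2 i ^ 2} :=
    (isOpen_lt (by fun_prop) (by fun_prop)).measurableSet
  have hQ : Integrable fun y : Fin n → ℝ ↦ ∏ i, gaussianPDFReal 0 v (y i) :=
    Integrable.fintype_prod fun _ ↦ integrable_gaussianPDFReal 0 v
  have hF := (integrable_gaussianPDFReal 0 v).mul_prod hQ
  obtain ⟨hq1, hq2⟩ := integral_prod_gaussianPDFReal_mul_sum_sq n v hv
  rw [← integral_indicator hS, Measure.volume_eq_prod, integral_prod_symm _ (hF.indicator hS)]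
  calc _ ≤ ∫ y : Fin n → ℝ, ((√(2 * π * v))⁻¹ * (2 / r) *
          ((∏ i, gaussianPDFReal 0 v (y i)) * ∑ i, y i ^ 2)
          + 4 / r ^ 2 * v * ∏ i, gaussianPDFReal 0 v (y i)) := by
        have hN : ∀ y : Fin n → ℝ, 0 ≤ ∏ i, gaussianPDFReal 0 v (y i) :=
          fun y ↦ Finset.prod_nonneg fun i _ ↦ gaussianPDFReal_nonneg 0 v _
        refine integral_mono_of_nonneg (ae_of_all _ fun y ↦ integral_nonneg fun s ↦ ?_)
          ((hq1.const_mul _).add (hQ.const_mul _)) (ae_of_all _ fun y ↦ ?_)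
        · exact Set.indicator_nonneg
            (fun p _ ↦ mul_nonneg (gaussianPDFReal_nonneg 0 v _) (hN _)) _
        · have h := mul_le_mul_of_nonneg_right (integral_gap_gaussianPDFReal_le v hv
            (q := ∑ i, y i ^ 2) hr hη (by positivity)) (hN y)
          rw [← integral_mul_const] at h
          calc _ = _ := ?_
            _ ≤ _ := h
            _ = _ := by ring
          refine integral_congr_ae (ae_of_all _ fun s ↦ ?_)
          simp only [Set.indicator, Set.mem_ofPred_eq, ite_mul, zero_mul]
    _ = _ := by
        rw [integral_add (hq1.const_mul _) (hQ.const_mul _), integral_const_mul,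
          integral_const_mul, hq2, integral_fintype_prod_volume_eq_prod]
        simp [integral_gaussianPDFReal_eq_one 0 hv]

theorem exists_measurePreserving_split_of_norm_eq_one {n : ℕ}
    (e : EuclideanSpace ℝ (Fin (n + 1))) (he : ‖e‖ = 1) :
    ∃ Φ : EuclideanSpace ℝ (Fin (n + 1)) ≃ᵐ ℝ × (Fin n → ℝ), MeasurePreserving Φ ∧
      ∀ z, (Φ z).1 = inner ℝ e z ∧ ‖z‖ ^ 2 = (Φ z).1 ^ 2 + ∑ i, (Φ z).2 i ^ 2 := by
  obtain ⟨b, hb⟩ := Orthonormal.exists_orthonormalBasis_extension_of_card_eq (𝕜 := ℝ)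
    (E := EuclideanSpace ℝ (Fin (n + 1))) (ι := Fin (n + 1)) (by simp) (v := fun _ ↦ e)
    (s := {0}) (by
      rw [orthonormal_iff_ite]
      rintro ⟨i, hi⟩ ⟨j, hj⟩
      rw [Set.mem_singleton_iff] at hi hj
      subst hi hj
      simp [Set.domRestrict, he])
  refine ⟨(b.measurableEquiv.trans (MeasurableEquiv.toLp 2 (Fin (n + 1) → ℝ)).symm).trans
    (MeasurableEquiv.piFinSuccAbove (fun _ ↦ ℝ) 0), ?_, fun z ↦ ?_⟩
  · exact (volume_preserving_piFinSuccAbove (fun _ ↦ ℝ) 0).comp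
      ((EuclideanSpace.volume_preserving_symm_measurableEquiv_toLp _).comp
        b.measurePreserving_measurableEquiv)
  · have h0 := hb 0 rfl
    have h1 := b.repr_apply_apply z 0
    rw [h0] at h1
    refine ⟨h1, ?_⟩
    rw [← b.repr.norm_map z, EuclideanSpace.real_norm_sq_eq, Fin.sum_univ_succ]
    rfl

theorem gap_of_notMem_closedBall {E : Type*} [NormedAddCommGroup E] [InnerProductSpace ℝ E]
    {e z : E} (he : ‖e‖ = 1) {r η : ℝ} (hr : 0 < r)
    (h₁ : z ∉ Metric.closedBall ((η - r) • e) r) (h₂ : z ∉ Metric.closedBall ((η + r) • e) r) :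
    2 * r * |inner ℝ e z - η| < (inner ℝ e z - η) ^ 2 + (‖z‖ ^ 2 - inner ℝ e z ^ 2) := by
  have key : ∀ a : ℝ, z ∉ Metric.closedBall (a • e) r →
      r ^ 2 < ‖z‖ ^ 2 - 2 * (a * inner ℝ e z) + a ^ 2 := by
    intro a ha
    rw [Metric.mem_closedBall, not_le, dist_eq_norm] at ha
    have h := pow_lt_pow_left₀ ha hr.le two_ne_zero
    rwa [norm_sub_sq_real, real_inner_smul_right, norm_smul, he, mul_one, Real.norm_eq_abs,
      sq_abs, real_inner_comm] at h
  have k1 := key _ h₁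
  have k2 := key _ h₂
  rcases abs_cases (inner ℝ e z - η) with ⟨h, -⟩ | ⟨h, -⟩ <;> rw [h] <;> nlinarith

open ProbabilityTheory in
theorem rpow_mul_exp_eq_prod_gaussianPDFReal (n : ℕ) {σ : ℝ} (v : NNReal)
    (hv : (v : ℝ) = σ ^ 2) (s : ℝ) (y : Fin n → ℝ) :
    (2 * π * σ ^ 2) ^ (-((n + 1 : ℕ) : ℝ) / 2) *
        Real.exp (-(s ^ 2 + ∑ i, y i ^ 2) / (2 * σ ^ 2))
      = gaussianPDFReal 0 v s * ∏ i, gaussianPDFReal 0 v (y i) := by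
  simp only [gaussianPDFReal, hv, sub_zero, Finset.prod_mul_distrib, Finset.prod_const,
    Finset.card_univ, Fintype.card_fin, ← Real.exp_sum]
  have h : (2 * π * σ ^ 2) ^ (-((n + 1 : ℕ) : ℝ) / 2) = (√(2 * π * σ ^ 2))⁻¹ ^ (n + 1) := by
    rw [inv_pow, Real.sqrt_eq_rpow, ← Real.rpow_mul_natCast (by positivity),
      ← Real.rpow_neg (by positivity)]
    congr 1
    ring
  rw [h, pow_succ', mul_mul_mul_comm, ← Real.exp_add, ← Finset.sum_div, Finset.sum_neg_distrib]
  ring_nf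

theorem setIntegral_sub_setIntegral_le_of_subset_union {α : Type*} [MeasurableSpace α]
    {μ : Measure α} {f : α → ℝ} (hf : Integrable f μ) (hf0 : 0 ≤ f) {A B G : Set α}
    (hG : MeasurableSet G) (h : A ⊆ B ∪ G) :
    (∫ x in A, f x ∂μ) - ∫ x in B, f x ∂μ ≤ ∫ x in G, f x ∂μ := by
  have h1 : ∫ x in A, f x ∂μ ≤ ∫ x in B ∪ G, f x ∂μ :=
    setIntegral_mono_set hf.integrableOn (ae_of_all _ hf0) h.eventuallyLE
  have h2 : ∫ x in B \ G, f x ∂μ ≤ ∫ x in B, f x ∂μ :=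
    setIntegral_mono_set hf.integrableOn (ae_of_all _ hf0) Set.sdiff_subset.eventuallyLE
  rw [← Set.sdiff_union_self, setIntegral_union Set.disjoint_sdiff_left hG hf.integrableOn
    hf.integrableOn] at h1
  linarith

/-- For balls of radius `r` tangent (at `η • e`) to the hyperplane `{z : ⟪z, e⟫ = η}` on the
side containing `0` and on the opposite side respectively, the Gaussian mass outside the first
ball exceeds the Gaussian mass inside the second by at most `Cσ`, uniformly over
`η ∈ [0, min r √σ]`. -/
theorem stmt11 {d : ℕ} (hd : 1 ≤ d) (r : ℝ) (hr : 0 < r)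
    (e : EuclideanSpace ℝ (Fin d)) (he : ‖e‖ = 1) :
    ∃ C > (0 : ℝ), ∃ σ₀ > (0 : ℝ), ∀ σ : ℝ, 0 < σ → σ < σ₀ →
      ∀ η : ℝ, η ∈ Set.Icc 0 (min r (Real.sqrt σ)) →
      (∫ z in (Metric.closedBall ((η - r) • e) r)ᶜ,
          (2 * π * σ ^ 2) ^ (-(d : ℝ) / 2) * Real.exp (-‖z‖ ^ 2 / (2 * σ ^ 2)))
      - (∫ z in Metric.closedBall ((η + r) • e) r,
          (2 * π * σ ^ 2) ^ (-(d : ℝ) / 2) * Real.exp (-‖z‖ ^ 2 / (2 * σ ^ 2)))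
      ≤ C * σ := by
  obtain ⟨n, rfl⟩ : ∃ n, d = n + 1 := ⟨d - 1, by omega⟩
  obtain ⟨Φ, hΦ, hΦz⟩ := exists_measurePreserving_split_of_norm_eq_one e he
  refine ⟨2 / r * n + 4 / r ^ 2, by positivity, min 1 (r ^ 2 / 4), by positivity, ?_⟩
  intro σ hσ hσ' η hη
  obtain ⟨hσ1, hσr⟩ := lt_min_iff.1 hσ'
  have hηr : |η| ≤ r / 2 := by
    rw [abs_of_nonneg hη.1]
    refine (hη.2.trans (min_le_right _ _)).trans (Real.sqrt_le_iff.2 ⟨by positivity, ?_⟩)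
    linarith
  obtain ⟨v, hv⟩ : ∃ v : NNReal, (v : ℝ) = σ ^ 2 := ⟨⟨σ ^ 2, sq_nonneg σ⟩, rfl⟩
  have hv0 : v ≠ 0 := by
    rw [← NNReal.coe_ne_zero, hv]
    positivity
  have hf : ∀ z : EuclideanSpace ℝ (Fin (n + 1)),
      (2 * π * σ ^ 2) ^ (-((n + 1 : ℕ) : ℝ) / 2) * Real.exp (-‖z‖ ^ 2 / (2 * σ ^ 2))
      = (fun p : ℝ × (Fin n → ℝ) ↦
          ProbabilityTheory.gaussianPDFReal 0 v p.1 *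
            ∏ i, ProbabilityTheory.gaussianPDFReal 0 v (p.2 i)) (Φ z) := by
    intro z
    rw [(hΦz z).2, rpow_mul_exp_eq_prod_gaussianPDFReal n v hv]
  have hS : MeasurableSet
      {p : ℝ × (Fin n → ℝ) | 2 * r * |p.1 - η| < (p.1 - η) ^ 2 + ∑ i, p.2 i ^ 2} :=
    (isOpen_lt (by fun_prop) (by fun_prop)).measurableSet
  have hF := (ProbabilityTheory.integrable_gaussianPDFReal 0 v).mul_prod (Integrable.fintype_prod
    (f := fun _ : Fin n ↦ ProbabilityTheory.gaussianPDFReal 0 v)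
    fun _ ↦ ProbabilityTheory.integrable_gaussianPDFReal 0 v)
  simp_rw [hf]
  refine (setIntegral_sub_setIntegral_le_of_subset_union
    ((hΦ.integrable_comp_emb Φ.measurableEmbedding).2 hF) (fun z ↦ ?_)
    (Φ.measurable hS) (fun z hz ↦ ?_)).trans ?_
  · exact mul_nonneg (ProbabilityTheory.gaussianPDFReal_nonneg 0 v _)
      (Finset.prod_nonneg fun i _ ↦ ProbabilityTheory.gaussianPDFReal_nonneg 0 v _)
  · rw [Set.mem_union]
    refine or_iff_not_imp_left.2 fun hz2 ↦ ?_
    have h := gap_of_notMem_closedBall he hr hz hz2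
    rw [(hΦz z).2, ← (hΦz z).1, add_sub_cancel_left] at h
    exact h
  · refine (hΦ.setIntegral_preimage_emb Φ.measurableEmbedding _ _).le.trans
      ((setIntegral_gap_gaussianPDFReal_prod_le n v hv0 hr hηr).trans ?_)
    have hM : (√(2 * π * v))⁻¹ ≤ σ⁻¹ := by
      refine inv_anti₀ hσ (Real.le_sqrt_of_sq_le ?_)
      rw [hv]
      nlinarith [Real.pi_gt_three, sq_nonneg σ]
    calc (√(2 * π * v))⁻¹ * (2 / r) * (n * v) + 4 / r ^ 2 * v
        ≤ σ⁻¹ * (2 / r) * (n * v) + 4 / r ^ 2 * v := by gcongr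
      _ = 2 / r * n * σ + 4 / r ^ 2 * (σ * σ) := by
        rw [hv]
        field_simp
      _ ≤ 2 / r * n * σ + 4 / r ^ 2 * (1 * σ) := by gcongr
      _ = _ := by ring
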